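/- Let n ≥ m ≥ 2 be even integers. Then for every vertex v of the grid graph L_{n,m}, n + m ≤ f_d(L_{n,m}, v) ≤ 2m + n − 2. -/

import Mathlib

open SimpleGraph

variable {V : Type*}

/-- The eccentricity of a vertex: the maximum graph distance to any vertex. -/
noncomputable def ecc [Fintype V] (G : SimpleGraph V) (u : V) : ℕ :=
  Finset.univ.sup fun w => G.dist u w

/-- The diameter of a graph: the maximum eccentricity. -/
noncomputable def graphDiam [Fintype V] (G : SimpleGraph V) : ℕ :=
  Finset.univ.sup fun u => ecc G u

/-- A nonempty set `U` of vertices is closed if for every `u ∈ U` and every vertex `v`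
there is `x ∈ U` with `dist u v = dist u x`. -/
def IsClosedSet (G : SimpleGraph V) (U : Set V) : Prop :=
  U.Nonempty ∧ ∀ u ∈ U, ∀ v : V, ∃ x ∈ U, G.dist u v = G.dist u x

/-- An Explorer strategy (assigning a called distance to each history, most recent
vertex first) is valid if, whenever the current vertex `u` has a legal call available
(`1 ≤ ecc u`), it calls some `k` with `1 ≤ k ≤ ecc u`. -/
def EValid [Fintype V] (G : SimpleGraph V) (ES : List V → ℕ) : Prop :=
  ∀ h : List V, ∀ u : V, h.head? = some u → 1 ≤ ecc G u →
    1 ≤ ES h ∧ ES h ≤ ecc G u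

/-- A Director strategy is valid if, for each history with current vertex `u` and each
legal called distance `k` (`1 ≤ k ≤ ecc u`), it answers a vertex at distance exactly `k`. -/
def DValid [Fintype V] (G : SimpleGraph V) (DS : List V → ℕ → V) : Prop :=
  ∀ h : List V, ∀ u : V, h.head? = some u → ∀ k : ℕ, 1 ≤ k → k ≤ ecc G u →
    G.dist u (DS h k) = k

/-- The history (most recent vertex first) of the first `n` moves of the play determined
by Explorer strategy `ES` and Director strategy `DS`, starting at `v`. -/
def play (ES : List V → ℕ) (DS : List V → ℕ → V) (v : V) : ℕ → List V
  | 0 => [v]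
  | n + 1 => DS (play ES DS v n) (ES (play ES DS v n)) :: play ES DS v n

/-- The number of distinct vertices visited in the play determined by `ES` and `DS`
starting at `v`. -/
noncomputable def playScore (ES : List V → ℕ) (DS : List V → ℕ → V) (v : V) : ℕ :=
  Set.ncard {x : V | ∃ n : ℕ, x ∈ play ES DS v n}

/-- `fd G v` : the max over valid Explorer strategies of the min over valid Director
strategies of the number of distinct vertices visited. -/
noncomputable def fd [Fintype V] (G : SimpleGraph V) (v : V) : ℕ :=
  sSup {r : ℕ | ∃ ES : List V → ℕ, EValid G ES ∧
    r = sInf {s : ℕ | ∃ DS : List V → ℕ → V, DValid G DS ∧ s = playScore ES DS v}}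

/-- A play `x` is consistent with the nonadaptive strategy `S` from start `v` if it starts
at `v` and each step has the prescribed length. -/
def NAConsistent (G : SimpleGraph V) (S : List ℕ) (v : V) (x : ℕ → V) : Prop :=
  x 0 = v ∧ ∀ i < S.length, G.dist (x i) (x (i + 1)) = S.getD i 0

/-- A nonadaptive strategy is playable from `v` if every consistent initial segment
can be extended. -/
def NAPlayable (G : SimpleGraph V) (S : List ℕ) (v : V) : Prop :=
  ∀ x : ℕ → V, ∀ i < S.length, x 0 = v →
    (∀ j < i, G.dist (x j) (x (j + 1)) = S.getD j 0) →
    ∃ y : V, G.dist (x i) y = S.getD i 0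

/-- The score of a nonadaptive strategy `S` from `v`: the minimum over consistent plays
of the number of distinct vertices among `x 0, …, x S.length`. -/
noncomputable def naScore (G : SimpleGraph V) (S : List ℕ) (v : V) : ℕ :=
  sInf {k : ℕ | ∃ x : ℕ → V, NAConsistent G S v x ∧
    k = Set.ncard {w : V | ∃ i ≤ S.length, x i = w}}

/-- The `n × m` grid graph: the box product of two path graphs. -/
def gridGraph (n m : ℕ) : SimpleGraph (Fin n × Fin m) :=
  (pathGraph n) □ (pathGraph m)

/-- A walk in the path graph is at least as long as the difference of its endpoints. -/
lemma pathGraph_natDist_le_length {n : ℕ} {u v : Fin n} (p : (pathGraph n).Walk u v) :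
    Nat.dist u v ≤ p.length := by
  induction p with
  | nil => simp
  | cons h p ih =>
    rw [pathGraph_adj] at h
    simp only [Walk.length_cons, Nat.dist] at ih ⊢
    omega

lemma pathGraph_exists_walk_of_add_eq {n : ℕ} (d : ℕ) :
    ∀ u v : Fin n, (u : ℕ) + d = v → ∃ p : (pathGraph n).Walk u v, p.length = d := by
  induction d with
  | zero =>
    intro u v h
    obtain rfl : u = v := Fin.ext h
    exact ⟨.nil, rfl⟩
  | succ d ih =>
    intro u v h
    obtain ⟨p, hp⟩ := ih ⟨u + 1, by omega⟩ v (by simp only; omega)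
    exact ⟨.cons (pathGraph_adj.2 (Or.inl rfl)) p, by simp [hp]⟩

lemma pathGraph_edist {n : ℕ} (u v : Fin n) :
    (pathGraph n).edist u v = (Nat.dist u v : ℕ) := by
  have hle : ∀ u v : Fin n, (u : ℕ) ≤ v → (pathGraph n).edist u v ≤ (Nat.dist u v : ℕ) := by
    intro u v h
    obtain ⟨p, hp⟩ := pathGraph_exists_walk_of_add_eq (v - u) u v (by omega)
    rw [Nat.dist_eq_sub_of_le h, ← hp]
    exact edist_le p
  apply le_antisymm
  · rcases le_total (u : ℕ) v with h | h
    · exact hle u v h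
    · rw [edist_comm, Nat.dist_comm]
      exact hle v u h
  · obtain ⟨p, hp⟩ := (pathGraph_preconnected n u v).exists_walk_length_eq_edist
    rw [← hp]
    exact_mod_cast pathGraph_natDist_le_length p

lemma gridGraph_dist {n m : ℕ} (u v : Fin n × Fin m) :
    (gridGraph n m).dist u v =
      ((u.1 : ℕ) - v.1 + (v.1 - u.1)) + ((u.2 : ℕ) - v.2 + (v.2 - u.2)) := by
  rw [SimpleGraph.dist, gridGraph, edist_boxProd, pathGraph_edist, pathGraph_edist,
    ← Nat.cast_add, ENat.toNat_natCast]
  simp only [Nat.dist]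

lemma exists_dist_eq_of_le_ecc [Fintype V] {G : SimpleGraph V} (hG : G.Preconnected) {u : V}
    {k : ℕ} (hk : k ≤ ecc G u) : ∃ w, G.dist u w = k := by
  obtain ⟨w, -, hw⟩ := Finset.exists_mem_eq_sup Finset.univ ⟨u, Finset.mem_univ u⟩
    fun w => G.dist u w
  obtain ⟨p, hp⟩ := (hG u w).exists_walk_length_eq_dist
  rw [ecc, hw] at hk
  refine ⟨p.getVert k, ?_⟩
  rw [← length_eq_dist_of_subwalk hp (p.isSubwalk_take k), Walk.take_length]
  omega

lemma gridGraph_preconnected (n m : ℕ) : (gridGraph n m).Preconnected :=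
  (pathGraph_preconnected n).boxProd (pathGraph_preconnected m)

/-- Every vertex of a closed set of an even grid forces the corner farthest from it, and the
vertices at half the diameter from a corner force the adjacent corners. -/
lemma IsClosedSet.corners_mem {n m : ℕ} (hn : Even n) (hm : Even m) {U : Set (Fin n × Fin m)}
    (hU : IsClosedSet (gridGraph n m) U) :
    (∃ x ∈ U, (x.1 : ℕ) = 0 ∧ (x.2 : ℕ) = 0) ∧
      ∃ x ∈ U, (x.1 : ℕ) = n - 1 ∧ (x.2 : ℕ) = 0 := by
  obtain ⟨a, rfl⟩ := hn
  obtain ⟨b, rfl⟩ := hm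
  obtain ⟨⟨u, hu⟩, hU⟩ := hU
  have ha := u.1.2
  have hb := u.2.2
  have hreach : ∀ u ∈ U, ∀ p q : ℕ, p < a + a → q < b + b → ∃ x ∈ U,
      ((u.1 : ℕ) - p + (p - u.1)) + ((u.2 : ℕ) - q + (q - u.2)) =
        ((u.1 : ℕ) - x.1 + (x.1 - u.1)) + ((u.2 : ℕ) - x.2 + (x.2 - u.2)) := by
    intro u hu p q hp hq
    simpa only [gridGraph_dist] using hU u hu (⟨p, hp⟩, ⟨q, hq⟩)
  have h₀₀ : ∀ u ∈ U, a ≤ u.1 → b ≤ u.2 → ∃ x ∈ U, (x.1 : ℕ) = 0 ∧ (x.2 : ℕ) = 0 := by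
    intro u hu h1 h2
    obtain ⟨x, hx, h⟩ := hreach u hu 0 0 (by omega) (by omega)
    exact ⟨x, hx, by omega, by omega⟩
  have h₁₀ : ∀ u ∈ U, (u.1 : ℕ) < a → b ≤ u.2 →
      ∃ x ∈ U, (x.1 : ℕ) = a + a - 1 ∧ (x.2 : ℕ) = 0 := by
    intro u hu h1 h2
    obtain ⟨x, hx, h⟩ := hreach u hu (a + a - 1) 0 (by omega) (by omega)
    exact ⟨x, hx, by omega, by omega⟩
  have h₀₁ : ∀ u ∈ U, a ≤ u.1 → (u.2 : ℕ) < b →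
      ∃ x ∈ U, (x.1 : ℕ) = 0 ∧ (x.2 : ℕ) = b + b - 1 := by
    intro u hu h1 h2
    obtain ⟨x, hx, h⟩ := hreach u hu 0 (b + b - 1) (by omega) (by omega)
    exact ⟨x, hx, by omega, by omega⟩
  have h₁₁ : ∀ u ∈ U, (u.1 : ℕ) < a → (u.2 : ℕ) < b →
      ∃ x ∈ U, (x.1 : ℕ) = a + a - 1 ∧ (x.2 : ℕ) = b + b - 1 := by
    intro u hu h1 h2
    obtain ⟨x, hx, h⟩ := hreach u hu (a + a - 1) (b + b - 1) (by omega) (by omega)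
    exact ⟨x, hx, by omega, by omega⟩
  have hanti : ∀ u ∈ U, (u.1 : ℕ) < a ∧ b ≤ u.2 ∨ a ≤ u.1 ∧ (u.2 : ℕ) < b →
      ∃ x ∈ U, (x.1 : ℕ) = a + a - 1 ∧ (x.2 : ℕ) = 0 := by
    rintro u hu (⟨h1, h2⟩ | ⟨h1, h2⟩)
    · exact h₁₀ u hu h1 h2
    · obtain ⟨x, hx, h3, h4⟩ := h₀₁ u hu h1 h2
      exact h₁₀ x hx (by omega) (by omega)
  have hdiag : ∀ u ∈ U, (u.1 : ℕ) < a ∧ (u.2 : ℕ) < b ∨ a ≤ u.1 ∧ b ≤ u.2 →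
      ∃ x ∈ U, (x.1 : ℕ) = 0 ∧ (x.2 : ℕ) = 0 := by
    rintro u hu (⟨h1, h2⟩ | ⟨h1, h2⟩)
    · obtain ⟨x, hx, h3, h4⟩ := h₁₁ u hu h1 h2
      exact h₀₀ x hx (by omega) (by omega)
    · exact h₀₀ u hu h1 h2
  by_cases hq : (u.1 : ℕ) < a ∧ (u.2 : ℕ) < b ∨ a ≤ u.1 ∧ b ≤ u.2
  · obtain ⟨x, hx, h1, h2⟩ := hdiag u hu hq
    refine ⟨⟨x, hx, h1, h2⟩, ?_⟩
    obtain ⟨y, hy, h⟩ := hreach x hx a (b - 1) (by omega) (by omega)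
    exact hanti y hy (by omega)
  · obtain ⟨x, hx, h1, h2⟩ := hanti u hu (by omega)
    refine ⟨?_, ⟨x, hx, h1, h2⟩⟩
    obtain ⟨y, hy, h⟩ := hreach x hx (a - 1) (b - 1) (by omega) (by omega)
    exact hdiag y hy (by omega)

/-- The even distances from a corner already need `(n + m) / 2` vertices of a closed set. -/
lemma card_filter_even_dist_ge {n m : ℕ} (hn : Even n) (hm : Even m)
    {U : Finset (Fin n × Fin m)} (hU : IsClosedSet (gridGraph n m) (U : Set (Fin n × Fin m)))
    {c : Fin n × Fin m} (hcU : c ∈ U) (hc₁ : (c.1 : ℕ) = 0 ∨ (c.1 : ℕ) = n - 1)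
    (hc₂ : (c.2 : ℕ) = 0) :
    (n + m) / 2 ≤ (U.filter fun x => Even ((gridGraph n m).dist c x)).card := by
  have hcn := c.1.2
  have hcm := c.2.2
  have hsub : Finset.range ((n + m) / 2) ⊆
      (U.filter fun x => Even ((gridGraph n m).dist c x)).image
        fun x => (gridGraph n m).dist c x / 2 := by
    intro t ht
    rw [Finset.mem_range] at ht
    obtain ⟨a, rfl⟩ := hn
    obtain ⟨b, rfl⟩ := hm
    have hv : ∃ v : Fin (a + a) × Fin (b + b),
        (gridGraph (a + a) (b + b)).dist c v = 2 * t := by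
      rcases hc₁ with h | h
      · exact ⟨(⟨2 * t - (2 * t - (a + a - 1)), by omega⟩, ⟨2 * t - (a + a - 1), by omega⟩), by
          simp only [gridGraph_dist]
          omega⟩
      · exact ⟨(⟨a + a - 1 - 2 * t, by omega⟩, ⟨2 * t - (a + a - 1), by omega⟩), by
          simp only [gridGraph_dist]
          omega⟩
    obtain ⟨v, hv⟩ := hv
    obtain ⟨x, hx, h⟩ := hU.2 c hcU v
    rw [Finset.mem_image]
    refine ⟨x, Finset.mem_filter.2 ⟨hx, ?_⟩, ?_⟩
    · rw [← h, hv]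
      exact even_two_mul t
    · rw [← h, hv]
      omega
  simpa using (Finset.card_le_card hsub).trans Finset.card_image_le

lemma IsClosedSet.add_le_card {n m : ℕ} (hn : Even n) (hm : Even m) {U : Finset (Fin n × Fin m)}
    (hU : IsClosedSet (gridGraph n m) (U : Set (Fin n × Fin m))) : n + m ≤ U.card := by
  obtain ⟨⟨c, hc, hc1, hc2⟩, d, hd, hd1, hd2⟩ := hU.corners_mem hn hm
  have h1 := card_filter_even_dist_ge hn hm hU hc (Or.inl hc1) hc2
  have h2 := card_filter_even_dist_ge hn hm hU hd (Or.inr hd1) hd2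
  have hdisj : Disjoint (U.filter fun x => Even ((gridGraph n m).dist c x))
      (U.filter fun x => Even ((gridGraph n m).dist d x)) := by
    rw [Finset.disjoint_filter]
    intro x _ h3 h4
    have := c.1.2
    have := x.1.2
    simp only [gridGraph_dist, Nat.even_iff] at h3 h4 hn
    omega
  have h3 := Finset.card_le_card
    (Finset.union_subset (Finset.filter_subset _ _) (Finset.filter_subset _ _) :
      (U.filter fun x => Even ((gridGraph n m).dist c x)) ∪
        (U.filter fun x => Even ((gridGraph n m).dist d x)) ⊆ U)
  rw [Finset.card_union_of_disjoint hdisj] at h3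
  obtain ⟨a, rfl⟩ := hn
  obtain ⟨b, rfl⟩ := hm
  omega

/-- The union of the two extreme columns and the row at height `b`. -/
def hShape (n m b : ℕ) : Finset (Fin n × Fin m) :=
  Finset.univ.filter fun x => (x.1 : ℕ) = 0 ∨ (x.1 : ℕ) = n - 1 ∨ (x.2 : ℕ) = b

lemma hShape_isClosedSet {n m : ℕ} (v : Fin n × Fin m) :
    IsClosedSet (gridGraph n m) (hShape n m v.2 : Set (Fin n × Fin m)) := by
  refine ⟨⟨v, by simp [hShape]⟩, ?_⟩
  intro u hu w
  have hu' : (u.1 : ℕ) = 0 ∨ (u.1 : ℕ) = n - 1 ∨ (u.2 : ℕ) = v.2 := by simpa [hShape] using hu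
  have := u.1.2
  have := u.2.2
  have := v.2.2
  have := w.1.2
  have := w.2.2
  suffices h : ∃ p q : ℕ, p < n ∧ q < m ∧ (p = 0 ∨ p = n - 1 ∨ q = v.2) ∧
      ((u.1 : ℕ) - w.1 + (w.1 - u.1)) + ((u.2 : ℕ) - w.2 + (w.2 - u.2)) =
        ((u.1 : ℕ) - p + (p - u.1)) + ((u.2 : ℕ) - q + (q - u.2)) by
    obtain ⟨p, q, hp, hq, h1, h2⟩ := h
    exact ⟨(⟨p, hp⟩, ⟨q, hq⟩), by simpa [hShape] using h1, by simpa only [gridGraph_dist] using h2⟩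
  generalize hD : ((u.1 : ℕ) - w.1 + (w.1 - u.1)) + ((u.2 : ℕ) - w.2 + (w.2 - u.2)) = D
  generalize hb : (v.2 : ℕ) = b at *
  rcases hu' with h | h | h
  · by_cases h1 : D ≤ u.2
    · exact ⟨0, u.2 - D, by omega, by omega, by omega, by omega⟩
    by_cases h2 : D ≤ m - 1 - u.2
    · exact ⟨0, u.2 + D, by omega, by omega, by omega, by omega⟩
    by_cases h3 : D ≤ n - 1 + (u.2 - b + (b - u.2))
    · exact ⟨D - (u.2 - b + (b - u.2)), b, by omega, by omega, by omega, by omega⟩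
    by_cases h4 : D - (n - 1) ≤ u.2
    · exact ⟨n - 1, u.2 - (D - (n - 1)), by omega, by omega, by omega, by omega⟩
    · exact ⟨n - 1, u.2 + (D - (n - 1)), by omega, by omega, by omega, by omega⟩
  · by_cases h1 : D ≤ u.2
    · exact ⟨n - 1, u.2 - D, by omega, by omega, by omega, by omega⟩
    by_cases h2 : D ≤ m - 1 - u.2
    · exact ⟨n - 1, u.2 + D, by omega, by omega, by omega, by omega⟩
    by_cases h3 : D ≤ n - 1 + (u.2 - b + (b - u.2))
    · exact ⟨n - 1 - (D - (u.2 - b + (b - u.2))), b, by omega, by omega, by omega, by omega⟩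
    by_cases h4 : D - (n - 1) ≤ u.2
    · exact ⟨0, u.2 - (D - (n - 1)), by omega, by omega, by omega, by omega⟩
    · exact ⟨0, u.2 + (D - (n - 1)), by omega, by omega, by omega, by omega⟩
  · by_cases h1 : D ≤ u.1
    · exact ⟨u.1 - D, b, by omega, by omega, by omega, by omega⟩
    by_cases h2 : D ≤ n - 1 - u.1
    · exact ⟨u.1 + D, b, by omega, by omega, by omega, by omega⟩
    by_cases h3 : (u.1 : ℕ) ≤ n - 1 - u.1
    · by_cases h4 : D - (n - 1 - u.1) ≤ b
      · exact ⟨n - 1, b - (D - (n - 1 - u.1)), by omega, by omega, by omega, by omega⟩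
      · exact ⟨n - 1, b + (D - (n - 1 - u.1)), by omega, by omega, by omega, by omega⟩
    · by_cases h4 : D - u.1 ≤ b
      · exact ⟨0, b - (D - u.1), by omega, by omega, by omega, by omega⟩
      · exact ⟨0, b + (D - u.1), by omega, by omega, by omega, by omega⟩

lemma hShape_card_le {n m : ℕ} (hn : 2 ≤ n) (b : Fin m) :
    (hShape n m b).card ≤ 2 * m + n - 2 := by
  have hm := b.2
  have hsub : hShape n m b ⊆
      (({⟨0, by omega⟩, ⟨n - 1, by omega⟩} : Finset (Fin n)) ×ˢ Finset.univ) ∪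
        ((Finset.univ \ {⟨0, by omega⟩, ⟨n - 1, by omega⟩}) ×ˢ {b}) := by
    intro x
    simp only [hShape, Finset.mem_filter, Finset.mem_union, Finset.mem_product,
      Finset.mem_insert, Finset.mem_singleton, Finset.mem_sdiff, Finset.mem_univ, Fin.ext_iff]
    tauto
  have hpair : ({⟨0, by omega⟩, ⟨n - 1, by omega⟩} : Finset (Fin n)).card = 2 :=
    Finset.card_pair (by simp only [ne_eq, Fin.ext_iff]; omega)
  have h := (Finset.card_le_card hsub).trans (Finset.card_union_le _ _)
  rw [Finset.card_product, Finset.card_product, Finset.card_sdiff_of_subset (Finset.subset_univ _),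
    hpair] at h
  simp only [Finset.card_univ, Fintype.card_fin, Finset.card_singleton] at h
  omega

lemma play_subset {ES : List V → ℕ} {DS : List V → ℕ → V} {v : V} {U : Set V} (hv : v ∈ U)
    (hstep : ∀ (h : List V) (u : V), h.head? = some u → u ∈ U → DS h (ES h) ∈ U) :
    {x | ∃ t, x ∈ play ES DS v t} ⊆ U := by
  have key : ∀ t, ∃ u, (play ES DS v t).head? = some u ∧ ∀ x ∈ play ES DS v t, x ∈ U := by
    intro t
    induction t with
    | zero => exact ⟨v, by simp [play], by simpa [play] using hv⟩
    | succ t ih =>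
      obtain ⟨u, hu, h⟩ := ih
      refine ⟨_, rfl, ?_⟩
      simp only [play, List.mem_cons, forall_eq_or_imp]
      exact ⟨hstep _ u hu (h u (List.mem_of_head? hu)), h⟩
  rintro x ⟨t, hx⟩
  obtain ⟨u, -, h⟩ := key t
  exact h x hx

/-- The Director can confine the token to a closed set containing the start. -/
lemma IsClosedSet.exists_dValid_playScore_le [Fintype V] {G : SimpleGraph V} {U : Finset V}
    (hG : G.Preconnected) (hecc : ∀ u, 1 ≤ ecc G u) (hU : IsClosedSet G (U : Set V)) {v : V}
    (hv : v ∈ U) :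
    ∃ DS, DValid G DS ∧ ∀ ES, EValid G ES → playScore ES DS v ≤ U.card := by
  have hex : ∀ (h : List V) (k : ℕ), ∃ y : V, ∀ u, h.head? = some u → k ≤ ecc G u →
      G.dist u y = k ∧ (u ∈ U → y ∈ U) := by
    intro h k
    by_cases hh : ∃ u, h.head? = some u ∧ k ≤ ecc G u
    · obtain ⟨u, hu, hk⟩ := hh
      obtain ⟨w, hw⟩ := exists_dist_eq_of_le_ecc hG hk
      by_cases huU : u ∈ U
      · obtain ⟨x, hx, h1⟩ := hU.2 u huU w
        refine ⟨x, fun u' hu' _ => ?_⟩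
        obtain rfl : u = u' := Option.some.inj (hu.symm.trans hu')
        exact ⟨h1.symm.trans hw, fun _ => hx⟩
      · refine ⟨w, fun u' hu' _ => ?_⟩
        obtain rfl : u = u' := Option.some.inj (hu.symm.trans hu')
        exact ⟨hw, fun h => absurd h huU⟩
    · exact ⟨v, fun u hu hk => absurd ⟨u, hu, hk⟩ hh⟩
  choose DS hDS using hex
  refine ⟨DS, fun h u hu k _ hk => (hDS h k u hu hk).1, fun ES hES => ?_⟩
  rw [playScore, ← Set.ncard_coe_finset U]
  refine Set.ncard_le_ncard (play_subset (by simpa using hv) ?_) U.finite_toSet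
  intro h u hu huU
  exact (hDS h _ u hu (hES h u hu (hecc u)).2).2 huU

open Classical in
/-- The Explorer strategy that cycles through all legal calls at each vertex. -/
noncomputable def cyclicStrategy [Fintype V] (G : SimpleGraph V) : List V → ℕ
  | [] => 0
  | u :: t => t.count u % ecc G u + 1

lemma cyclicStrategy_eValid [Fintype V] (G : SimpleGraph V) : EValid G (cyclicStrategy G) := by
  rintro (_ | ⟨a, t⟩) u hu hecc
  · simp at hu
  · obtain rfl : a = u := by simpa using hu
    exact ⟨Nat.succ_pos _, Nat.mod_lt _ hecc⟩

/-- The position after `t` moves of a play. -/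
def playPos (ES : List V → ℕ) (DS : List V → ℕ → V) (v : V) : ℕ → V
  | 0 => v
  | t + 1 => DS (play ES DS v t) (ES (play ES DS v t))

open Classical in
lemma exists_play_eq_cons (ES : List V → ℕ) (DS : List V → ℕ → V) (v : V) (t : ℕ) :
    ∃ l, play ES DS v t = playPos ES DS v t :: l ∧
      ∀ u, l.count u = Nat.count (fun s => playPos ES DS v s = u) t := by
  induction t with
  | zero => exact ⟨[], rfl, by simp⟩
  | succ t ih =>
    obtain ⟨l, hl, h⟩ := ih
    refine ⟨play ES DS v t, rfl, fun u => ?_⟩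
    rw [hl, List.count_cons, Nat.count_succ, h]
    simp

/-- The vertices visited infinitely often against the cyclic strategy form a closed set. -/
lemma exists_isClosedSet_card_le_playScore [Fintype V] {G : SimpleGraph V}
    {DS : List V → ℕ → V} (hDS : DValid G DS) (v : V) :
    ∃ U : Finset V, IsClosedSet G (U : Set V) ∧ U.card ≤ playScore (cyclicStrategy G) DS v := by
  classical
  set X := playPos (cyclicStrategy G) DS v with hX
  refine ⟨Finset.univ.filter fun x => ∃ᶠ t in Filter.atTop, X t = x, ⟨?_, ?_⟩, ?_⟩
  · by_contra! hne
    have h : ∀ᶠ t in Filter.atTop, ∀ x, X t ≠ x := by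
      rw [Filter.eventually_all]
      intro x
      rw [← Filter.not_frequently]
      intro hx
      have : x ∈ (∅ : Set V) := by
        rw [← hne]
        simpa using hx
      exact this
    obtain ⟨t, ht⟩ := h.exists
    exact ht _ rfl
  · intro u hu w
    have hu' : ∃ᶠ t in Filter.atTop, X t = u := by simpa using hu
    rcases Nat.eq_zero_or_pos (G.dist u w) with h0 | hpos
    · exact ⟨u, hu, by simpa using h0⟩
    have hk : G.dist u w ≤ ecc G u :=
      Finset.le_sup (f := fun w => G.dist u w) (Finset.mem_univ w)
    have hinf := Nat.frequently_atTop_iff_infinite.1 hu'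
    have hcall : ∃ᶠ t in Filter.atTop, G.dist u w = G.dist u (X (t + 1)) := by
      rw [Filter.frequently_atTop]
      intro N
      set q := ecc G u * N + (G.dist u w - 1) with hq
      have hqt : X (Nat.nth (fun s => X s = u) q) = u := Nat.nth_mem_of_infinite hinf q
      refine ⟨Nat.nth (fun s => X s = u) q, ?_, ?_⟩
      · have h1 := (Nat.nth_strictMono hinf).le_apply (x := q)
        have h2 : 1 * N ≤ ecc G u * N := Nat.mul_le_mul_right N (hpos.trans_le hk)
        omega
      · obtain ⟨l, hl, hcount⟩ := exists_play_eq_cons (cyclicStrategy G) DS v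
          (Nat.nth (fun s => X s = u) q)
        rw [← hX, hqt] at hl
        have hc : cyclicStrategy G (u :: l) = G.dist u w := by
          rw [cyclicStrategy, hcount u, ← hX, Nat.count_nth_of_infinite hinf, hq,
            Nat.mul_add_mod, Nat.mod_eq_of_lt (by omega)]
          omega
        rw [hX, playPos, hl, hc]
        exact (hDS (u :: l) u rfl _ hpos hk).symm
    by_contra! hne
    have h : ∀ᶠ t in Filter.atTop, ∀ x, G.dist u w = G.dist u x → X t ≠ x := by
      rw [Filter.eventually_all]
      intro x
      by_cases hx : G.dist u w = G.dist u x
      · have hxU : ¬ ∃ᶠ t in Filter.atTop, X t = x := fun hf => hne x (by simpa using hf) hx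
        filter_upwards [Filter.not_frequently.1 hxU] with t ht _ using ht
      · exact Filter.Eventually.of_forall fun t h' => absurd h' hx
    obtain ⟨t, h1, h2⟩ :=
      (hcall.and_eventually ((Filter.tendsto_add_atTop_nat 1).eventually h)).exists
    exact h2 _ h1 rfl
  · rw [playScore, ← Set.ncard_coe_finset]
    refine Set.ncard_le_ncard ?_ (Set.toFinite _)
    intro x hx
    obtain ⟨t, rfl⟩ := (show ∃ᶠ t in Filter.atTop, X t = x by simpa using hx).exists
    obtain ⟨l, hl, -⟩ := exists_play_eq_cons (cyclicStrategy G) DS v t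
    exact ⟨t, by rw [hl]; exact List.mem_cons_self⟩

/-- The value of the game lies between a lower bound on the size of closed sets and the size of
any closed set containing the start. -/
lemma fd_bounds [Fintype V] {G : SimpleGraph V} (hG : G.Preconnected) (hecc : ∀ u, 1 ≤ ecc G u)
    {N : ℕ} (hN : ∀ U : Finset V, IsClosedSet G (U : Set V) → N ≤ U.card) {v : V}
    {U : Finset V} (hU : IsClosedSet G (U : Set V)) (hv : v ∈ U) :
    N ≤ fd G v ∧ fd G v ≤ U.card := by
  obtain ⟨DS, hDS, hle⟩ := hU.exists_dValid_playScore_le hG hecc hv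
  have hub : ∀ r ∈ {r : ℕ | ∃ ES : List V → ℕ, EValid G ES ∧
      r = sInf {s : ℕ | ∃ DS : List V → ℕ → V, DValid G DS ∧ s = playScore ES DS v}},
      r ≤ U.card := by
    rintro r ⟨ES, hES, rfl⟩
    exact le_trans (Nat.sInf_le ⟨DS, hDS, rfl⟩) (hle ES hES)
  refine ⟨le_trans ?_ (le_csSup ⟨U.card, hub⟩ ⟨cyclicStrategy G, cyclicStrategy_eValid G, rfl⟩),
    csSup_le ⟨_, cyclicStrategy G, cyclicStrategy_eValid G, rfl⟩ hub⟩
  refine le_csInf ⟨_, DS, hDS, rfl⟩ ?_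
  rintro s ⟨DS', hDS', rfl⟩
  obtain ⟨W, hW, h⟩ := exists_isClosedSet_card_le_playScore hDS' v
  exact (hN W hW).trans h

lemma one_le_ecc_gridGraph {n m : ℕ} (hn : 2 ≤ n) (u : Fin n × Fin m) :
    1 ≤ ecc (gridGraph n m) u := by
  have hle : ∀ w, (gridGraph n m).dist u w ≤ ecc (gridGraph n m) u := fun w =>
    Finset.le_sup (f := fun w => (gridGraph n m).dist u w) (Finset.mem_univ w)
  have h0 := hle (⟨0, by omega⟩, u.2)
  have h1 := hle (⟨1, by omega⟩, u.2)
  simp only [gridGraph_dist] at h0 h1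
  omega

/-- For even `n ≥ m ≥ 2` and every starting vertex `v` of the grid
`L_{n,m}`, `n + m ≤ f_d(L_{n,m}, v) ≤ 2m + n - 2`. -/
theorem stmt_5 (n m : ℕ) (hm : 2 ≤ m) (hnm : m ≤ n) (hn : Even n) (hme : Even m)
    (v : Fin n × Fin m) :
    n + m ≤ fd (gridGraph n m) v ∧ fd (gridGraph n m) v ≤ 2 * m + n - 2 := by
  have h := fd_bounds (gridGraph_preconnected n m) (one_le_ecc_gridGraph (hm.trans hnm))
    (fun U hU => hU.add_le_card hn hme) (hShape_isClosedSet v)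
    (by simp [hShape] : v ∈ hShape n m v.2)
  exact ⟨h.1, h.2.trans (hShape_card_le (hm.trans hnm) v.2)⟩
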